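/- arXiv:1608.06405 — 6 statements merged into one kernel-verified Lean document; each statement's English description precedes it below -/
import Mathlib

section
/- Under the stated setup, the matrix Υ is positive definite. -/
open Matrix
open scoped ComplexOrder

lemma star_dotProduct_vecMulVec_star_mulVec {n : Type*} [Fintype n] (v x : n → ℂ) :
    star x ⬝ᵥ (vecMulVec v (star v) *ᵥ x) = ((Complex.normSq (star v ⬝ᵥ x) : ℝ) : ℂ) := by
  rw [vecMulVec_mulVec, Complex.normSq_eq_conj_mul_self]
  simp only [dotProduct_smul, MulOpposite.smul_eq_mul_unop, MulOpposite.unop_op]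
  congr 1
  rw [starRingEnd_apply, star_dotProduct]

/-- Full-rank step in the proof of Proposition 2: with `Θᵢₖ = gᵢₖ gᵢₖᴴ`,
`Υ = I + Σᵢₖ cᵢₖ λᵢₖ Θᵢₖ`, and `Ξₖ = Υ − λ₁ₖ e₁ₖ Θ₁ₖ − λ₂ₖ e₂ₖ Θ₂ₖ ⪰ 0` for all `k`,
the matrix `Υ` is positive definite. -/
theorem stmt_5 (N : ℕ) (K : Type*) [Fintype K]
    (g : Fin 2 → K → (Fin N → ℂ)) (lam c e : Fin 2 → K → ℝ)
    (hlam : ∀ i k, 0 ≤ lam i k) (he : ∀ i k, 0 < e i k)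
    (Υ : Matrix (Fin N) (Fin N) ℂ)
    (hΥ : Υ = 1 + ∑ i : Fin 2, ∑ k : K,
      ((c i k * lam i k : ℝ) : ℂ) • Matrix.vecMulVec (g i k) (star (g i k)))
    (hΞ : ∀ k : K,
      (Υ - ((lam 0 k * e 0 k : ℝ) : ℂ) • Matrix.vecMulVec (g 0 k) (star (g 0 k))
         - ((lam 1 k * e 1 k : ℝ) : ℂ) • Matrix.vecMulVec (g 1 k) (star (g 1 k))).PosSemidef) :
    Υ.PosDef := by
  have hΥ_herm : Υ.IsHermitian := by
    rw [hΥ]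
    refine isHermitian_one.add ?_
    simp [IsHermitian, conjTranspose_sum, conjTranspose_smul, conjTranspose_vecMulVec]
  refine PosDef.of_dotProduct_mulVec_pos hΥ_herm fun x hx => ?_
  set a : Fin 2 → K → ℝ := fun i k => Complex.normSq (star (g i k) ⬝ᵥ x)
  have ha_nonneg : ∀ i k, 0 ≤ a i k := fun i k => Complex.normSq_nonneg _
  obtain ⟨r, hr⟩ : ∃ r : ℝ, star x ⬝ᵥ x = (r : ℂ) :=
    ⟨∑ i, Complex.normSq (x i), by
      simp [dotProduct, Complex.normSq_eq_conj_mul_self]⟩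
  have hr_pos : 0 < r := by
    have h := dotProduct_star_self_pos_iff.mpr hx
    rw [hr] at h
    exact_mod_cast h
  have hq : star x ⬝ᵥ (Υ *ᵥ x) = ((r + ∑ i, ∑ k, c i k * lam i k * a i k : ℝ) : ℂ) := by
    rw [hΥ]
    simp only [add_mulVec, sum_mulVec, smul_mulVec, one_mulVec, dotProduct_add, dotProduct_sum,
      dotProduct_smul, star_dotProduct_vecMulVec_star_mulVec, hr, smul_eq_mul]
    push_cast
    rfl
  have hle : ∀ k, lam 0 k * e 0 k * a 0 k + lam 1 k * e 1 k * a 1 k ≤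
      r + ∑ i, ∑ k, c i k * lam i k * a i k := by
    intro k
    have h := (hΞ k).dotProduct_mulVec_nonneg x
    simp only [sub_mulVec, smul_mulVec, dotProduct_sub, dotProduct_smul,
      star_dotProduct_vecMulVec_star_mulVec, hq, smul_eq_mul] at h
    have h' : 0 ≤ (r + ∑ i, ∑ k, c i k * lam i k * a i k) - lam 0 k * e 0 k * a 0 k
        - lam 1 k * e 1 k * a 1 k := by exact_mod_cast h
    linarith
  rw [hq]
  norm_cast
  by_contra! hneg
  have hterm_nonneg : ∀ i k, 0 ≤ lam i k * e i k * a i k := fun i k =>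
    mul_nonneg (mul_nonneg (hlam i k) (he i k).le) (ha_nonneg i k)
  have hterm_zero : ∀ i k, lam i k * e i k * a i k = 0 := by
    intro i k
    have h0 := hterm_nonneg 0 k
    have h1 := hterm_nonneg 1 k
    have h := hle k
    fin_cases i <;> simp only [Fin.zero_eta, Fin.mk_one] <;> linarith
  have hsum : ∑ i, ∑ k, c i k * lam i k * a i k = 0 := by
    refine Finset.sum_eq_zero fun i _ => Finset.sum_eq_zero fun k _ => ?_
    have h : e i k * (lam i k * a i k) = 0 := by linarith [hterm_zero i k]
    rw [mul_assoc, (mul_eq_zero.mp h).resolve_left (he i k).ne', mul_zero]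
  linarith
end

section
/- Under the stated setup, for every k ∈ K and every N×N complex matrix V satisfying Ξ_k · V = 0, the rank of V is at most 2. In particular, this is the conclusion of Proposition 2 of the paper: any stationary point V_k of the rank-relaxed beamforming problem, which is positive semidefinite and satisfies the complementary slackness condition Ξ_k V_k = 0, has rank at most 2. -/
open Matrix
open scoped ComplexOrder

theorem Matrix.vecMulVec_star_mulVec {n : Type*} [Fintype n] (g x : n → ℂ) :
    vecMulVec g (star g) *ᵥ x = (star g ⬝ᵥ x) • g := by
  ext i
  simp [vecMulVec_mulVec, mul_comm]

theorem Matrix.dotProduct_smul_vecMulVec_star_mulVec {n : Type*} [Fintype n] (a : ℝ)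
    (g x : n → ℂ) :
    star x ⬝ᵥ (((a : ℂ) • vecMulVec g (star g)) *ᵥ x) =
      ((a * Complex.normSq (star g ⬝ᵥ x) : ℝ) : ℂ) := by
  have h : star x ⬝ᵥ g = star (star g ⬝ᵥ x) := star_dotProduct x g
  rw [smul_mulVec, dotProduct_smul, vecMulVec_star_mulVec, dotProduct_smul, h, smul_eq_mul,
    smul_eq_mul, Complex.ofReal_mul, Complex.normSq_eq_conj_mul_self, mul_comm (star g ⬝ᵥ x)]
  rfl

theorem Matrix.rank_smul_vecMulVec_le_one {n : Type*} [Fintype n] (a : ℂ) (v w : n → ℂ) :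
    (a • vecMulVec v w).rank ≤ 1 := by
  rw [← smul_vecMulVec]
  exact rank_vecMulVec_le _ _

theorem Matrix.rank_add_le_rank_add_rank {m n F : Type*} [Finite m] [Fintype n] [Field F]
    (A B : Matrix m n F) : (A + B).rank ≤ A.rank + B.rank := by
  rw [rank, rank, rank, mulVecLin_add]
  exact (Submodule.finrank_mono (LinearMap.range_add_le _ _)).trans
    (Submodule.finrank_add_le_finrank_add_finrank _ _)

/-- Conclusion of Proposition 2: with `Θᵢₖ = gᵢₖ gᵢₖᴴ`, `Υ = I + Σᵢₖ cᵢₖ λᵢₖ Θᵢₖ`,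
and `Ξₖ = Υ − λ₁ₖ e₁ₖ Θ₁ₖ − λ₂ₖ e₂ₖ Θ₂ₖ ⪰ 0` for all `k`, any matrix `V` satisfying
the complementary slackness condition `Ξₖ V = 0` has rank at most 2. -/
theorem stmt_6 (N : ℕ) (K : Type*) [Fintype K]
    (g : Fin 2 → K → (Fin N → ℂ)) (lam c e : Fin 2 → K → ℝ)
    (hlam : ∀ i k, 0 ≤ lam i k) (he : ∀ i k, 0 < e i k)
    (Υ : Matrix (Fin N) (Fin N) ℂ)
    (hΥ : Υ = 1 + ∑ i : Fin 2, ∑ k : K,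
      ((c i k * lam i k : ℝ) : ℂ) • Matrix.vecMulVec (g i k) (star (g i k)))
    (Ξ : K → Matrix (Fin N) (Fin N) ℂ)
    (hΞdef : ∀ k : K, Ξ k =
      Υ - ((lam 0 k * e 0 k : ℝ) : ℂ) • Matrix.vecMulVec (g 0 k) (star (g 0 k))
        - ((lam 1 k * e 1 k : ℝ) : ℂ) • Matrix.vecMulVec (g 1 k) (star (g 1 k)))
    (hΞ : ∀ k : K, (Ξ k).PosSemidef) :
    ∀ k : K, ∀ V : Matrix (Fin N) (Fin N) ℂ, Ξ k * V = 0 → V.rank ≤ 2 := by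
  intro k V hV
  have hker : ∀ x, Υ *ᵥ x = 0 → x = 0 := by
    intro x hx
    have hpair : ∀ j, lam 0 j * (star (g 0 j) ⬝ᵥ x) = 0 ∧ lam 1 j * (star (g 1 j) ⬝ᵥ x) = 0 := by
      intro j
      have h := (hΞ j).dotProduct_mulVec_nonneg x
      rw [hΞdef, sub_mulVec, sub_mulVec, hx, dotProduct_sub, dotProduct_sub, dotProduct_zero,
        dotProduct_smul_vecMulVec_star_mulVec, dotProduct_smul_vecMulVec_star_mulVec] at h
      have hreal : 0 ≤ 0 - lam 0 j * e 0 j * Complex.normSq (star (g 0 j) ⬝ᵥ x)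
          - lam 1 j * e 1 j * Complex.normSq (star (g 1 j) ⬝ᵥ x) := by
        exact_mod_cast h
      have hnonneg : ∀ i, 0 ≤ lam i j * e i j * Complex.normSq (star (g i j) ⬝ᵥ x) := fun i =>
        mul_nonneg (mul_nonneg (hlam i j) (he i j).le) (Complex.normSq_nonneg _)
      have h0 : lam 0 j * e 0 j * Complex.normSq (star (g 0 j) ⬝ᵥ x) = 0 := by
        linarith [hnonneg 0, hnonneg 1]
      have h1 : lam 1 j * e 1 j * Complex.normSq (star (g 1 j) ⬝ᵥ x) = 0 := by
        linarith [hnonneg 0, hnonneg 1]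
      simpa [(he 0 j).ne', (he 1 j).ne'] using And.intro h0 h1
    have hzero : ∀ i j, (lam i j : ℂ) * (star (g i j) ⬝ᵥ x) = 0 := by
      intro i j
      fin_cases i
      exacts [(hpair j).1, (hpair j).2]
    rw [hΥ, add_mulVec, one_mulVec, sum_mulVec] at hx
    rw [Finset.sum_eq_zero, add_zero] at hx
    · exact hx
    intro i _
    rw [sum_mulVec]
    refine Finset.sum_eq_zero fun j _ => ?_
    rw [smul_mulVec, vecMulVec_star_mulVec, smul_smul, Complex.ofReal_mul, mul_assoc, hzero,
      mul_zero, zero_smul]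
  have hunit : IsUnit Υ := by
    rw [← mulVec_injective_iff_isUnit]
    intro x y hxy
    exact sub_eq_zero.mp (hker _ (by rw [mulVec_sub]; exact sub_eq_zero.mpr hxy))
  have hmul : Υ * V = (((lam 0 k * e 0 k : ℝ) : ℂ) • vecMulVec (g 0 k) (star (g 0 k))
      + ((lam 1 k * e 1 k : ℝ) : ℂ) • vecMulVec (g 1 k) (star (g 1 k))) * V := by
    rw [hΞdef, sub_sub, sub_mul] at hV
    exact sub_eq_zero.mp hV
  rw [← rank_mul_eq_right_of_isUnit_det Υ V ((isUnit_iff_isUnit_det _).mp hunit), hmul]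
  exact (rank_mul_le_left _ _).trans ((rank_add_le_rank_add_rank _ _).trans
    (add_le_add (rank_smul_vecMulVec_le_one _ _ _) (rank_smul_vecMulVec_le_one _ _ _)))
end

section
/- Under the stated setup, if (q̄, b̄) is feasible for problem P5, then T(q̄)_{i,k} ≤ q̄_{i,k} for all i ∈ {1,2} and k ∈ K. -/
open Matrix Finset

/-- Interference-plus-noise covariance matrix `Jₖ(ω) = Σⱼ Σ_{l≠k} ω_{j,l} h_{j,l} h_{j,l}ᴴ + σ²I`. -/
noncomputable def Jmat {N : ℕ} {K : Type*} [Fintype K] [DecidableEq K]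
    (h : Fin 2 → K → (Fin N → ℂ)) (σ2 : ℝ) (ω : Fin 2 → K → ℝ) (k : K) :
    Matrix (Fin N) (Fin N) ℂ :=
  (∑ j : Fin 2, ∑ l ∈ Finset.univ.filter (fun l => l ≠ k),
      ((ω j l : ℝ) : ℂ) • Matrix.vecMulVec (h j l) (star (h j l))) + (σ2 : ℂ) • 1

/-- Fixed-point map `T(ω)_{i,k} = α_{i,k} / Re( h_{i,k}ᴴ Jₖ(ω)⁻¹ h_{i,k} )`. -/
noncomputable def Tmap {N : ℕ} {K : Type*} [Fintype K] [DecidableEq K]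
    (h : Fin 2 → K → (Fin N → ℂ)) (σ2 : ℝ) (α : Fin 2 → K → ℝ)
    (ω : Fin 2 → K → ℝ) (i : Fin 2) (k : K) : ℝ :=
  α i k / (star (h i k) ⬝ᵥ ((Jmat h σ2 ω k)⁻¹ *ᵥ h i k)).re

/-- Feasibility of a pair `(q, b)` for problem P5:
`q_{i,k} |b_{i,k}ᴴ h_{i,k}|² ≥ α_{i,k} (Σⱼ Σ_{l≠k} q_{j,l} |b_{i,k}ᴴ h_{j,l}|² + σ² ‖b_{i,k}‖²)`. -/
def FeasibleP5 {N : ℕ} {K : Type*} [Fintype K] [DecidableEq K]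
    (h : Fin 2 → K → (Fin N → ℂ)) (σ2 : ℝ) (α : Fin 2 → K → ℝ)
    (q : Fin 2 → K → ℝ) (b : Fin 2 → K → (Fin N → ℂ)) : Prop :=
  (∀ i k, 0 ≤ q i k) ∧ (∀ i k, b i k ≠ 0) ∧
  ∀ (i : Fin 2) (k : K),
    α i k * ((∑ j : Fin 2, ∑ l ∈ Finset.univ.filter (fun l => l ≠ k),
        q j l * ‖star (b i k) ⬝ᵥ h j l‖ ^ 2) + σ2 * (star (b i k) ⬝ᵥ b i k).re)
      ≤ q i k * ‖star (b i k) ⬝ᵥ h i k‖ ^ 2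

open scoped ComplexOrder

/-- Cauchy–Schwarz for the sesquilinear form of a positive semidefinite matrix. -/
theorem Matrix.PosSemidef.norm_dotProduct_mulVec_sq_le {𝕜 n : Type*} [RCLike 𝕜] [Fintype n]
    {M : Matrix n n 𝕜} (hM : M.PosSemidef) (x y : n → 𝕜) :
    ‖star x ⬝ᵥ (M *ᵥ y)‖ ^ 2 ≤
      RCLike.re (star x ⬝ᵥ (M *ᵥ x)) * RCLike.re (star y ⬝ᵥ (M *ᵥ y)) := by
  let _ := M.toSeminormedAddCommGroup hM
  let _ := M.toInnerProductSpace hM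
  have hinner (u v : n → 𝕜) : inner 𝕜 u v = star u ⬝ᵥ (M *ᵥ v) := dotProduct_comm _ _
  have hcs := inner_mul_inner_self_le (𝕜 := 𝕜) x y
  rw [norm_inner_symm y x, ← sq] at hcs
  simpa only [hinner] using hcs

theorem Matrix.star_dotProduct_vecMulVec_mulVec {n : Type*} [Fintype n] (v w : n → ℂ) :
    star v ⬝ᵥ (vecMulVec w (star w) *ᵥ v) = ((‖star v ⬝ᵥ w‖ ^ 2 : ℝ) : ℂ) := by
  rw [vecMulVec_mulVec, dotProduct_smul, op_smul_eq_smul, smul_eq_mul, mul_comm, star_dotProduct w]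
  simpa using Complex.mul_conj' (star v ⬝ᵥ w)

theorem Jmat_posDef {N : ℕ} {K : Type*} [Fintype K] [DecidableEq K]
    (h : Fin 2 → K → (Fin N → ℂ)) {σ2 : ℝ} (hσ : 0 < σ2) {ω : Fin 2 → K → ℝ}
    (hω : ∀ i k, 0 ≤ ω i k) (k : K) : (Jmat h σ2 ω k).PosDef := by
  refine Matrix.PosDef.posSemidef_add ?_ (Matrix.PosDef.one.smul (by exact_mod_cast hσ))
  exact posSemidef_sum _ fun j _ => posSemidef_sum _ fun l _ =>
    (posSemidef_vecMulVec_self_star _).smul (by exact_mod_cast hω j l)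

theorem re_star_dotProduct_Jmat_mulVec {N : ℕ} {K : Type*} [Fintype K] [DecidableEq K]
    (h : Fin 2 → K → (Fin N → ℂ)) (σ2 : ℝ) (ω : Fin 2 → K → ℝ) (k : K) (v : Fin N → ℂ) :
    (star v ⬝ᵥ (Jmat h σ2 ω k *ᵥ v)).re =
      (∑ j : Fin 2, ∑ l ∈ Finset.univ.filter (fun l => l ≠ k),
        ω j l * ‖star v ⬝ᵥ h j l‖ ^ 2) + σ2 * (star v ⬝ᵥ v).re := by
  simp only [Jmat, add_mulVec, sum_mulVec, smul_mulVec, one_mulVec, dotProduct_add,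
    dotProduct_sum, dotProduct_smul, star_dotProduct_vecMulVec_mulVec, smul_eq_mul,
    Complex.add_re, Complex.re_sum, Complex.re_ofReal_mul, Complex.ofReal_re]

/-- Any feasible power vector of P5 is a pre-fixed point of `T`
(proof of Proposition 3). -/
theorem stmt_11 {N : ℕ} {K : Type*} [Fintype K] [DecidableEq K]
    (h : Fin 2 → K → (Fin N → ℂ)) (σ2 : ℝ) (α : Fin 2 → K → ℝ)
    (hh : ∀ i k, h i k ≠ 0) (hα : ∀ i k, 0 < α i k) (hσ : 0 < σ2)
    (q : Fin 2 → K → ℝ) (b : Fin 2 → K → (Fin N → ℂ))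
    (hfeas : FeasibleP5 h σ2 α q b) :
    ∀ (i : Fin 2) (k : K), Tmap h σ2 α q i k ≤ q i k := by
  obtain ⟨hq, hb, hsinr⟩ := hfeas
  intro i k
  have hJ := Jmat_posDef h hσ hq k
  have hunit := (isUnit_iff_isUnit_det _).mp hJ.isUnit
  set J := Jmat h σ2 q k with hJdef
  have hJinv : J *ᵥ (J⁻¹ *ᵥ h i k) = h i k := by
    rw [mulVec_mulVec, mul_nonsing_inv _ hunit, one_mulVec]
  have hgain : 0 < (star (h i k) ⬝ᵥ (J⁻¹ *ᵥ h i k)).re :=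
    (Complex.pos_iff.mp (hJ.inv.dotProduct_mulVec_pos (hh i k))).1
  have hbJ : 0 < (star (b i k) ⬝ᵥ (J *ᵥ b i k)).re :=
    (Complex.pos_iff.mp (hJ.dotProduct_mulVec_pos (hb i k))).1
  have hcs := hJ.posSemidef.norm_dotProduct_mulVec_sq_le (b i k) (J⁻¹ *ᵥ h i k)
  have hself : star (J⁻¹ *ᵥ h i k) ⬝ᵥ h i k = star (h i k) ⬝ᵥ (J⁻¹ *ᵥ h i k) := by
    rw [star_mulVec, hJ.inv.isHermitian.eq, dotProduct_mulVec]
  rw [hJinv, hself] at hcs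
  simp only [RCLike.re_eq_complex_re] at hcs
  have hfeas := hsinr i k
  rw [← re_star_dotProduct_Jmat_mulVec, ← hJdef] at hfeas
  rw [Tmap, ← hJdef, div_le_iff₀ hgain]
  refine le_of_mul_le_mul_right ?_ hbJ
  linarith [mul_le_mul_of_nonneg_left hcs (hq i k)]
end

section
/- Under the stated setup, assume there exists at least one pair (q̄, b̄) feasible for problem P5. Then for every i ∈ {1,2}, k ∈ K the real sequence n ↦ ω^{[n]}_{i,k} produced by the iteration ω^{[0]} = 0, ω^{[n+1]} = T(ω^{[n]}) converges to a limit ω^{∞}_{i,k}; the limit is a fixed point of T, i.e. T(ω^{∞}) = ω^{∞}; and ω^{∞}_{i,k} ≤ q̄_{i,k} for every feasible pair (q̄, b̄) and all i, k (so ω^{∞} is componentwise optimal for P5). -/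
open Matrix Finset

section FixedPointIteration

open scoped ComplexOrder

namespace Matrix.PosDef

variable {n : Type*} [Fintype n] [DecidableEq n] {A : Matrix n n ℂ}

/-- The Cauchy–Schwarz inequality `|bᴴx|² ≤ (bᴴAb)(xᴴA⁻¹x)` for a positive definite matrix `A`. -/
theorem norm_sq_dotProduct_le (hA : A.PosDef) (b x : n → ℂ) :
    ‖star b ⬝ᵥ x‖ ^ 2 ≤ (star b ⬝ᵥ (A *ᵥ b)).re * (star x ⬝ᵥ (A⁻¹ *ᵥ x)).re := by
  rcases eq_or_ne x 0 with rfl | hx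
  · simp
  have hs := hA.inv.dotProduct_mulVec_pos hx
  have hAx : A *ᵥ (A⁻¹ *ᵥ x) = x := by
    rw [mulVec_mulVec, mul_nonsing_inv _ ((isUnit_iff_isUnit_det A).1 hA.isUnit), one_mulVec]
  have hxA (v : n → ℂ) : star (A⁻¹ *ᵥ x) ⬝ᵥ (A *ᵥ v) = star x ⬝ᵥ v := by
    rw [dotProduct_mulVec]
    conv_rhs => rw [← hAx, star_mulVec, hA.isHermitian.eq]
  set s := star x ⬝ᵥ (A⁻¹ *ᵥ x) with hs_def
  set z := star b ⬝ᵥ x with hz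
  have hzs : star x ⬝ᵥ b = star z := star_dotProduct _ _
  have hxx : star (A⁻¹ *ᵥ x) ⬝ᵥ x = s := by
    rw [hs_def, ← hxA, hAx]
  have hsr : s = (s.re : ℂ) := Complex.eq_re_of_ofReal_le hs.le
  have hs0 : 0 < s.re := (Complex.pos_iff.1 hs).1
  have hv := (Complex.nonneg_iff.1
    (hA.posSemidef.dotProduct_mulVec_nonneg ((s.re : ℂ) • b - (star z) • (A⁻¹ *ᵥ x)))).1
  have key : star ((s.re : ℂ) • b - (star z) • (A⁻¹ *ᵥ x)) ⬝ᵥ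
      (A *ᵥ ((s.re : ℂ) • b - (star z) • (A⁻¹ *ᵥ x))) =
      (s.re : ℂ) * ((s.re : ℂ) * (star b ⬝ᵥ (A *ᵥ b)) - z * star z) := by
    simp only [mulVec_sub, mulVec_smul, star_sub, star_smul, sub_dotProduct, dotProduct_sub,
      smul_dotProduct, dotProduct_smul, hAx, hxA, hzs, smul_eq_mul, star_star, hxx, ← hz]
    rw [← hsr]
    have : star s = s := by rw [hsr]; exact Complex.conj_ofReal _
    rw [this]
    ring
  have hzz : z * star z = ((‖z‖ ^ 2 : ℝ) : ℂ) := by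
    rw [Complex.star_def, Complex.mul_conj, Complex.normSq_eq_norm_sq]
  rw [key, hzz, Complex.re_ofReal_mul, Complex.sub_re, Complex.re_ofReal_mul,
    Complex.ofReal_re] at hv
  nlinarith [nonneg_of_mul_nonneg_right hv hs0]

end Matrix.PosDef

variable {N : ℕ} {K : Type*} [Fintype K] [DecidableEq K]
  {h : Fin 2 → K → (Fin N → ℂ)} {σ2 : ℝ} {α ω ω' : Fin 2 → K → ℝ}

theorem posDef_Jmat (hσ : 0 < σ2) (hω : 0 ≤ ω) (k : K) : (Jmat h σ2 ω k).PosDef := by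
  refine Matrix.PosDef.posSemidef_add ?_ (Matrix.PosDef.one.smul (by exact_mod_cast hσ))
  refine Matrix.posSemidef_sum _ fun j _ ↦ Matrix.posSemidef_sum _ fun l _ ↦ ?_
  exact (Matrix.posSemidef_vecMulVec_self_star _).smul (by exact_mod_cast hω j l)

theorem re_dotProduct_Jmat_mulVec (h : Fin 2 → K → (Fin N → ℂ)) (σ2 : ℝ) (ω : Fin 2 → K → ℝ)
    (k : K) (b : Fin N → ℂ) :
    (star b ⬝ᵥ (Jmat h σ2 ω k *ᵥ b)).re =
      (∑ j : Fin 2, ∑ l ∈ Finset.univ.filter (fun l => l ≠ k), ω j l * ‖star b ⬝ᵥ h j l‖ ^ 2) +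
        σ2 * (star b ⬝ᵥ b).re := by
  have hterm (x : Fin N → ℂ) : star b ⬝ᵥ (Matrix.vecMulVec x (star x) *ᵥ b) =
      ((‖star b ⬝ᵥ x‖ ^ 2 : ℝ) : ℂ) := by
    have hx : star x ⬝ᵥ b = star (star b ⬝ᵥ x) := star_dotProduct _ _
    rw [Matrix.vecMulVec_mulVec, op_smul_eq_smul, dotProduct_smul, hx, smul_eq_mul, mul_comm,
      Complex.star_def, Complex.mul_conj, Complex.normSq_eq_norm_sq]
  simp only [Jmat, Matrix.add_mulVec, Matrix.sum_mulVec, Matrix.smul_mulVec, Matrix.one_mulVec,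
    dotProduct_add, dotProduct_sum, dotProduct_smul, hterm, smul_eq_mul, Complex.add_re,
    Complex.re_sum, Complex.re_ofReal_mul, Complex.ofReal_re]

theorem re_dotProduct_Jmat_mulVec_mono (hω : ω ≤ ω') (k : K) (b : Fin N → ℂ) :
    (star b ⬝ᵥ (Jmat h σ2 ω k *ᵥ b)).re ≤ (star b ⬝ᵥ (Jmat h σ2 ω' k *ᵥ b)).re := by
  simp only [re_dotProduct_Jmat_mulVec]
  gcongr with j _ l _
  exact hω j l

theorem re_dotProduct_inv_Jmat_mulVec_pos (hh : ∀ i k, h i k ≠ 0) (hσ : 0 < σ2) (hω : 0 ≤ ω)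
    (i : Fin 2) (k : K) : 0 < (star (h i k) ⬝ᵥ ((Jmat h σ2 ω k)⁻¹ *ᵥ h i k)).re :=
  (Complex.pos_iff.1 ((posDef_Jmat hσ hω k).inv.dotProduct_mulVec_pos (hh i k))).1

theorem Tmap_nonneg (hh : ∀ i k, h i k ≠ 0) (hα : ∀ i k, 0 < α i k) (hσ : 0 < σ2) (hω : 0 ≤ ω) :
    0 ≤ Tmap h σ2 α ω := fun i k ↦
  (div_pos (hα i k) (re_dotProduct_inv_Jmat_mulVec_pos hh hσ hω i k)).le

/-- Every beamformer gives an upper bound on `T(ω)`. -/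
theorem Tmap_mul_norm_sq_le (hh : ∀ i k, h i k ≠ 0) (hα : ∀ i k, 0 < α i k) (hσ : 0 < σ2)
    (hω : 0 ≤ ω) (i : Fin 2) (k : K) (b : Fin N → ℂ) :
    Tmap h σ2 α ω i k * ‖star b ⬝ᵥ h i k‖ ^ 2 ≤
      α i k * (star b ⬝ᵥ (Jmat h σ2 ω k *ᵥ b)).re := by
  have hs := re_dotProduct_inv_Jmat_mulVec_pos hh hσ hω i k
  rw [Tmap, div_mul_eq_mul_div, div_le_iff₀ hs, mul_assoc]
  exact mul_le_mul_of_nonneg_left ((posDef_Jmat hσ hω k).norm_sq_dotProduct_le b _) (hα i k).le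

/-- The bound of `Tmap_mul_norm_sq_le` is attained at the MMSE beamformer `Jₖ(ω)⁻¹ h_{i,k}`. -/
theorem exists_Tmap_mul_norm_sq_eq (hh : ∀ i k, h i k ≠ 0) (hσ : 0 < σ2)
    (hω : 0 ≤ ω) (i : Fin 2) (k : K) :
    ∃ b : Fin N → ℂ, 0 < ‖star b ⬝ᵥ h i k‖ ∧
      Tmap h σ2 α ω i k * ‖star b ⬝ᵥ h i k‖ ^ 2 =
        α i k * (star b ⬝ᵥ (Jmat h σ2 ω k *ᵥ b)).re := by
  have hJ := posDef_Jmat (h := h) hσ hω k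
  have hs := re_dotProduct_inv_Jmat_mulVec_pos hh hσ hω i k
  have hsc := hJ.inv.dotProduct_mulVec_pos (hh i k)
  have hb : star ((Jmat h σ2 ω k)⁻¹ *ᵥ h i k) ⬝ᵥ h i k =
      star (h i k) ⬝ᵥ ((Jmat h σ2 ω k)⁻¹ *ᵥ h i k) := by
    rw [Matrix.star_mulVec, hJ.inv.isHermitian.eq, Matrix.dotProduct_mulVec]
  have hJb : Jmat h σ2 ω k *ᵥ ((Jmat h σ2 ω k)⁻¹ *ᵥ h i k) = h i k := by
    rw [Matrix.mulVec_mulVec,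
      Matrix.mul_nonsing_inv _ ((Matrix.isUnit_iff_isUnit_det _).1 hJ.isUnit), Matrix.one_mulVec]
  have hnorm : ‖star (h i k) ⬝ᵥ ((Jmat h σ2 ω k)⁻¹ *ᵥ h i k)‖ =
      (star (h i k) ⬝ᵥ ((Jmat h σ2 ω k)⁻¹ *ᵥ h i k)).re :=
    (Complex.re_eq_norm.2 hsc.le).symm
  refine ⟨(Jmat h σ2 ω k)⁻¹ *ᵥ h i k, ?_, ?_⟩
  · rwa [hb, hnorm]
  · rw [hJb, hb, hnorm, Tmap]
    field_simp

theorem Tmap_mono (hh : ∀ i k, h i k ≠ 0) (hα : ∀ i k, 0 < α i k) (hσ : 0 < σ2)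
    (hω : 0 ≤ ω) (hωω' : ω ≤ ω') : Tmap h σ2 α ω ≤ Tmap h σ2 α ω' := fun i k ↦ by
  obtain ⟨b, hb, hTb⟩ := exists_Tmap_mul_norm_sq_eq (α := α) hh hσ (hω.trans hωω') i k
  refine le_of_mul_le_mul_right ?_ (pow_pos hb 2)
  rw [hTb]
  exact (Tmap_mul_norm_sq_le hh hα hσ hω i k b).trans
    (mul_le_mul_of_nonneg_left (re_dotProduct_Jmat_mulVec_mono hωω' k b) (hα i k).le)

theorem FeasibleP5.Tmap_le {q : Fin 2 → K → ℝ} {b : Fin 2 → K → (Fin N → ℂ)}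
    (hqb : FeasibleP5 h σ2 α q b) (hh : ∀ i k, h i k ≠ 0) (hα : ∀ i k, 0 < α i k)
    (hσ : 0 < σ2) : Tmap h σ2 α q ≤ q := fun i k ↦ by
  obtain ⟨hq, hb, hqb⟩ := hqb
  have hle := hqb i k
  rw [← re_dotProduct_Jmat_mulVec] at hle
  have hpos : 0 < q i k * ‖star (b i k) ⬝ᵥ h i k‖ ^ 2 := hle.trans_lt' <| mul_pos (hα i k)
    (Complex.pos_iff.1 ((posDef_Jmat hσ hq k).dotProduct_mulVec_pos (hb i k))).1
  exact le_of_mul_le_mul_right ((Tmap_mul_norm_sq_le hh hα hσ hq i k (b i k)).trans hle)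
    (pos_of_mul_pos_right hpos (hq i k))

theorem continuous_Jmat (h : Fin 2 → K → (Fin N → ℂ)) (σ2 : ℝ) (k : K) :
    Continuous fun ω ↦ Jmat h σ2 ω k := by
  unfold Jmat
  fun_prop

theorem continuousAt_Tmap (hh : ∀ i k, h i k ≠ 0) (hσ : 0 < σ2) (hω : 0 ≤ ω) :
    ContinuousAt (Tmap h σ2 α) ω := by
  refine continuousAt_pi.2 fun i ↦ continuousAt_pi.2 fun k ↦ ?_
  have hdet := (Matrix.isUnit_iff_isUnit_det _).1 (posDef_Jmat (h := h) hσ hω k).isUnit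
  have hinv : ContinuousAt (fun ω ↦ (Jmat h σ2 ω k)⁻¹) ω := by
    refine ContinuousAt.comp (f := fun ω ↦ Jmat h σ2 ω k) (g := Inv.inv)
      (continuousAt_matrix_inv _ ?_) (continuous_Jmat h σ2 k).continuousAt
    rw [Ring.inverse_eq_inv']
    exact continuousAt_inv₀ hdet.ne_zero
  have hform : Continuous fun A : Matrix (Fin N) (Fin N) ℂ ↦
      (star (h i k) ⬝ᵥ (A *ᵥ h i k)).re := by fun_prop
  exact continuousAt_const.div (hform.continuousAt.comp hinv)
    (re_dotProduct_inv_Jmat_mulVec_pos hh hσ hω i k).ne'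

theorem Tmap_iterate_nonneg (hh : ∀ i k, h i k ≠ 0) (hα : ∀ i k, 0 < α i k) (hσ : 0 < σ2)
    (n : ℕ) : 0 ≤ (Tmap h σ2 α)^[n] 0 := by
  induction n with
  | zero => exact le_rfl
  | succ n ih =>
    rw [Function.iterate_succ_apply']
    exact Tmap_nonneg hh hα hσ ih

theorem monotone_Tmap_iterate (hh : ∀ i k, h i k ≠ 0) (hα : ∀ i k, 0 < α i k) (hσ : 0 < σ2) :
    Monotone fun n : ℕ ↦ (Tmap h σ2 α)^[n] 0 := by
  refine monotone_nat_of_le_succ fun n ↦ ?_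
  induction n with
  | zero => exact Tmap_iterate_nonneg hh hα hσ 1
  | succ n ih =>
    rw [Function.iterate_succ_apply', Function.iterate_succ_apply' _ (n + 1)]
    exact Tmap_mono hh hα hσ (Tmap_iterate_nonneg hh hα hσ n) ih

theorem FeasibleP5.Tmap_iterate_le {q : Fin 2 → K → ℝ} {b : Fin 2 → K → (Fin N → ℂ)}
    (hqb : FeasibleP5 h σ2 α q b) (hh : ∀ i k, h i k ≠ 0) (hα : ∀ i k, 0 < α i k)
    (hσ : 0 < σ2) (n : ℕ) : (Tmap h σ2 α)^[n] 0 ≤ q := by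
  induction n with
  | zero => exact hqb.1
  | succ n ih =>
    rw [Function.iterate_succ_apply']
    exact (Tmap_mono hh hα hσ (Tmap_iterate_nonneg hh hα hσ n) ih).trans
      (hqb.Tmap_le hh hα hσ)

end FixedPointIteration

/-- Proposition 3: if P5 is feasible, the iteration `ω⁰ = 0`, `ωⁿ⁺¹ = T(ωⁿ)` converges
componentwise, the limit is a fixed point of `T`, and it is componentwise optimal. -/
theorem stmt_13 {N : ℕ} {K : Type*} [Fintype K] [DecidableEq K]
    (h : Fin 2 → K → (Fin N → ℂ)) (σ2 : ℝ) (α : Fin 2 → K → ℝ)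
    (hh : ∀ i k, h i k ≠ 0) (hα : ∀ i k, 0 < α i k) (hσ : 0 < σ2)
    (hfeas : ∃ (q : Fin 2 → K → ℝ) (b : Fin 2 → K → (Fin N → ℂ)), FeasibleP5 h σ2 α q b) :
    ∃ ωinf : Fin 2 → K → ℝ,
      (∀ (i : Fin 2) (k : K),
        Filter.Tendsto (fun n : ℕ => (Tmap h σ2 α)^[n] 0 i k)
          Filter.atTop (nhds (ωinf i k))) ∧
      Tmap h σ2 α ωinf = ωinf ∧
      (∀ (q : Fin 2 → K → ℝ) (b : Fin 2 → K → (Fin N → ℂ)),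
        FeasibleP5 h σ2 α q b → ∀ (i : Fin 2) (k : K), ωinf i k ≤ q i k) := by
  obtain ⟨q₀, b₀, hqb₀⟩ := hfeas
  have hlim := tendsto_atTop_ciSup (monotone_Tmap_iterate hh hα hσ)
    ⟨q₀, Set.forall_mem_range.2 (hqb₀.Tmap_iterate_le hh hα hσ)⟩
  have hnonneg := ge_of_tendsto' hlim (Tmap_iterate_nonneg hh hα hσ)
  exact ⟨_, fun i k ↦ tendsto_pi_nhds.1 (tendsto_pi_nhds.1 hlim i) k,
    isFixedPt_of_tendsto_iterate hlim (continuousAt_Tmap hh hσ hnonneg),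
    fun q b hqb ↦ le_of_tendsto' hlim (hqb.Tmap_iterate_le hh hα hσ)⟩
end

section
/- Let p, q, r be real numbers with p > q ≥ 0 and r > 0, and define f(a) = min( √a · p, √a · q + √(1−a) · r ) for a ∈ [0,1]. Set a1 = 1, a2 = q^2/(q^2 + r^2), and a3 = r^2/((p−q)^2 + r^2). Then for every a ∈ [0,1]: f(a) ≤ max( f(a1), f(a2), f(a3) ); i.e., the maximum of f over [0,1] is attained at one of the three candidate points a1, a2, a3. -/
/-- The first coordinate of the normalization of `(u, v)`, for `u ≥ 0`. -/
lemma sqrt_sq_div_sq_add_sq {u v : ℝ} (hu : 0 ≤ u) :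
    Real.sqrt (u ^ 2 / (u ^ 2 + v ^ 2)) = u / Real.sqrt (u ^ 2 + v ^ 2) := by
  rw [Real.sqrt_div (sq_nonneg u), Real.sqrt_sq hu]

lemma sqrt_one_sub_sq_div_sq_add_sq {u v : ℝ} (hv : 0 ≤ v) (h : 0 < u ^ 2 + v ^ 2) :
    Real.sqrt (1 - u ^ 2 / (u ^ 2 + v ^ 2)) = v / Real.sqrt (u ^ 2 + v ^ 2) := by
  rw [one_sub_div h.ne', add_sub_cancel_left, Real.sqrt_div (sq_nonneg v), Real.sqrt_sq hv]

/-- On the unit circle, `q x + r y` decreases as the point `(x, y)` moves away from the direction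
`(q, r)` towards the `x`-axis. -/
lemma mul_add_mul_le_of_unit {q r x y x' y' : ℝ} (hq : 0 ≤ q) (hr : 0 ≤ r)
    (hx' : 0 < x') (hxx : x' ≤ x) (hyy : y ≤ y') (h : x ^ 2 + y ^ 2 = x' ^ 2 + y' ^ 2)
    (hdir : q * y' ≤ r * x') : x * q + y * r ≤ x' * q + y' * r := by
  have hsum : q * (y' + y) ≤ r * (x' + x) := by
    nlinarith [mul_le_mul_of_nonneg_left hyy hq, mul_le_mul_of_nonneg_left hxx hr]
  have hmul : q * (x - x') * (x + x') ≤ r * (y' - y) * (x + x') := by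
    have := mul_le_mul_of_nonneg_left hsum (sub_nonneg.2 hyy)
    have he : (x - x') * (x + x') = (y' - y) * (y' + y) := by linarith
    linear_combination this + q * he
  have := le_of_mul_le_mul_right hmul (by linarith)
  linarith

/-- Closed-form one-dimensional search of Appendix F: the maximum over `[0,1]` of
`f(a) = min(√a·p, √a·q + √(1−a)·r)` is attained at one of the three candidate points
`a1 = 1`, `a2 = q²/(q²+r²)`, `a3 = r²/((p−q)²+r²)`. -/
theorem stmt_16 (p q r : ℝ) (hpq : q < p) (hq : 0 ≤ q) (hr : 0 < r)
    (f : ℝ → ℝ)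
    (hf : ∀ a : ℝ, f a = min (Real.sqrt a * p) (Real.sqrt a * q + Real.sqrt (1 - a) * r)) :
    ∀ a ∈ Set.Icc (0 : ℝ) 1,
      f a ≤ max (f 1) (max (f (q ^ 2 / (q ^ 2 + r ^ 2))) (f (r ^ 2 / ((p - q) ^ 2 + r ^ 2)))) := by
  rintro a ⟨ha0, ha1⟩
  have hd : 0 < p - q := sub_pos.2 hpq
  have hp : 0 ≤ p := hq.trans hpq.le
  have hS : 0 < q ^ 2 + r ^ 2 := by positivity
  have hD : 0 < r ^ 2 + (p - q) ^ 2 := by positivity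
  rw [add_comm ((p - q) ^ 2)]
  set b := r ^ 2 / (r ^ 2 + (p - q) ^ 2) with hb
  have hxb : √b = r / √(r ^ 2 + (p - q) ^ 2) := sqrt_sq_div_sq_add_sq hr.le
  have hyb : √(1 - b) = (p - q) / √(r ^ 2 + (p - q) ^ 2) :=
    sqrt_one_sub_sq_div_sq_add_sq hd.le hD
  have hcross : √b * p = √b * q + √(1 - b) * r := by
    rw [hxb, hyb]; ring
  have hfb : f b = √b * p := by rw [hf, ← hcross, min_self]
  rcases le_total a b with hab | hba
  · refine le_max_of_le_right (le_max_of_le_right ?_)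
    rw [hfb, hf]
    exact (min_le_left _ _).trans (mul_le_mul_of_nonneg_right (Real.sqrt_le_sqrt hab) hp)
  have hunit : √a ^ 2 + √(1 - a) ^ 2 = 1 := by
    rw [Real.sq_sqrt ha0, Real.sq_sqrt (sub_nonneg.2 ha1)]; ring
  rcases le_total (r ^ 2) (q * (p - q)) with hpeak | hpeak
  · refine le_max_of_le_right (le_max_of_le_left ?_)
    rw [hf, hf (q ^ 2 / _), sqrt_sq_div_sq_add_sq hq, sqrt_one_sub_sq_div_sq_add_sq hr.le hS]
    have hs : 0 < √(q ^ 2 + r ^ 2) := Real.sqrt_pos.2 hS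
    have hcs : √a * q + √(1 - a) * r ≤ √(q ^ 2 + r ^ 2) := by
      apply Real.le_sqrt_of_sq_le
      have : (√a * q + √(1 - a) * r) ^ 2 + (√a * r - √(1 - a) * q) ^ 2 = q ^ 2 + r ^ 2 := by
        linear_combination (q ^ 2 + r ^ 2) * hunit
      linarith [sq_nonneg (√a * r - √(1 - a) * q)]
    have hss : √(q ^ 2 + r ^ 2) * √(q ^ 2 + r ^ 2) = q ^ 2 + r ^ 2 := Real.mul_self_sqrt hS.le
    refine (min_le_right _ _).trans (hcs.trans (le_min ?_ ?_))
    · rw [div_mul_eq_mul_div, le_div_iff₀ hs]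
      linarith
    · rw [div_mul_eq_mul_div, div_mul_eq_mul_div, ← add_div, le_div_iff₀ hs]
      linarith
  · refine le_max_of_le_right (le_max_of_le_right ?_)
    rw [hfb, hcross, hf]
    have hb0 : 0 < b := by positivity
    refine (min_le_right _ _).trans (mul_add_mul_le_of_unit hq hr.le (Real.sqrt_pos.2 hb0)
      (Real.sqrt_le_sqrt hba) (Real.sqrt_le_sqrt (by linarith)) ?_ ?_)
    · rw [hunit, Real.sq_sqrt hb0.le, Real.sq_sqrt (by linarith)]; ring
    · rw [hxb, hyb, ← mul_div_assoc, ← mul_div_assoc]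
      exact div_le_div_of_nonneg_right (by linarith) (Real.sqrt_nonneg _)
end

section
/- Let θ, s_u, s_z, C be positive real numbers and η ∈ (0,1). Define B = θ·s_z − (θ+1)·s_u + C/η and β* = 2·θ·s_z / ( B + √( B^2 + 4·θ·(θ+1)·s_u·s_z ) ). Then: (a) 0 < β* < 1; (b) θ·( s_u + s_z/β* ) = C/( η·(1−β*) ) − s_u; and (c) for every β ∈ (0,1): max( θ·( s_u + s_z/β ), C/( η·(1−β) ) − s_u ) ≥ max( θ·( s_u + s_z/β* ), C/( η·(1−β*) ) − s_u ). -/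
/-- The rationalized root `2b / (B + √(B² + 4ab))` of `a x² + B x - b` is positive and is a root. -/
theorem rationalized_root_pos_and_eq {a b B : ℝ} (ha : 0 < a) (hb : 0 < b) :
    0 < 2 * b / (B + √(B ^ 2 + 4 * a * b)) ∧
      a * (2 * b / (B + √(B ^ 2 + 4 * a * b))) ^ 2 + B * (2 * b / (B + √(B ^ 2 + 4 * a * b)))
        = b := by
  have hab : 0 < a * b := mul_pos ha hb
  have hS : √(B ^ 2 + 4 * a * b) ^ 2 = B ^ 2 + 4 * a * b :=
    Real.sq_sqrt (by nlinarith [sq_nonneg B])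
  have hlt : -B < √(B ^ 2 + 4 * a * b) := Real.lt_sqrt_of_sq_lt (by nlinarith)
  set S := √(B ^ 2 + 4 * a * b)
  have hD : 0 < B + S := by linarith
  refine ⟨by positivity, ?_⟩
  field_simp
  linear_combination -hS

/-- Large-N power-splitting optimization of Appendix G: with
`B = θ·s_z − (θ+1)·s_u + C/η` and
`β* = 2θ·s_z / (B + √(B² + 4θ(θ+1)·s_u·s_z))`, one has `0 < β* < 1`, the two terms
`θ(s_u + s_z/β)` and `C/(η(1−β)) − s_u` are equal at `β = β*`, and `β*` minimizes
their maximum over `β ∈ (0,1)`. -/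
theorem stmt_17 (θ su sz C η : ℝ)
    (hθ : 0 < θ) (hsu : 0 < su) (hsz : 0 < sz) (hC : 0 < C)
    (hη0 : 0 < η) (hη1 : η < 1)
    (B βs : ℝ)
    (hB : B = θ * sz - (θ + 1) * su + C / η)
    (hβs : βs = 2 * θ * sz / (B + Real.sqrt (B ^ 2 + 4 * θ * (θ + 1) * su * sz))) :
    (0 < βs ∧ βs < 1) ∧
    θ * (su + sz / βs) = C / (η * (1 - βs)) - su ∧
    ∀ β : ℝ, 0 < β → β < 1 →
      max (θ * (su + sz / βs)) (C / (η * (1 - βs)) - su)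
        ≤ max (θ * (su + sz / β)) (C / (η * (1 - β)) - su) := by
  have hb : 0 < θ * sz := mul_pos hθ hsz
  have ha : 0 < (θ + 1) * su := by positivity
  have hK : 0 < C / η := div_pos hC hη0
  obtain ⟨hpos, hroot⟩ := rationalized_root_pos_and_eq (B := B) ha hb
  have hβ : βs = 2 * (θ * sz) / (B + √(B ^ 2 + 4 * ((θ + 1) * su) * (θ * sz))) := by
    rw [hβs]; ring_nf
  rw [← hβ] at hpos hroot
  have hlt : βs < 1 := by
    by_contra! h
    nlinarith [mul_le_mul_of_nonneg_left h ha.le,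
      mul_nonneg hpos.le (mul_nonneg ha.le (sub_nonneg.2 h))]
  have h1 : 0 < 1 - βs := sub_pos.2 hlt
  have heq : θ * (su + sz / βs) = C / (η * (1 - βs)) - su := by
    rw [hB] at hroot
    field_simp at hroot ⊢
    linear_combination -hroot
  refine ⟨⟨hpos, hlt⟩, heq, fun β hβ0 hβ1 => ?_⟩
  have h2 : 0 < 1 - β := sub_pos.2 hβ1
  rcases le_total β βs with h | h
  · rw [← heq, max_self]
    refine le_max_of_le_left ?_
    gcongr
  · rw [heq, max_self]
    refine le_max_of_le_right ?_
    gcongr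
end
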